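/- arXiv:0902.2767 — 3 statements merged into one kernel-verified Lean document; each statement's English description precedes it below -/
import Mathlib

section
/- Let π be a μ-projective unitary representation of a countable discrete group G on a complex separable Hilbert space H and suppose {π(g)ξ}_{g∈G} is a Parseval frame for H. Then (i) {π(g)η}_{g∈G} is a Parseval frame for H if and only if there is a unitary operator U ∈ π(G)'' with η = Uξ; and (ii) {π(g)η}_{g∈G} is a frame for H if and only if there is an invertible operator U ∈ π(G)'' with η = Uξ. -/
open scoped InnerProductSpace

noncomputable section

variable {G : Type*} {H : Type*} [NormedAddCommGroup H] [InnerProductSpace ℂ H]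

/-- `π` is a projective unitary representation of `G` on `H` with multiplier `mu`:
each `π g` is a unitary operator (a surjective linear isometry) and
`π g ∘ π h = mu g h • π (g * h)`, where `|mu g h| = 1`. -/
def IsProjUnitaryRep [Group G] (mu : G → G → ℂ) (π : G → H →L[ℂ] H) : Prop :=
  (∀ g h, ‖mu g h‖ = 1) ∧
  (∀ g, (∀ x : H, ‖π g x‖ = ‖x‖) ∧ Function.Surjective (π g)) ∧
  (∀ g h, (π g).comp (π h) = mu g h • π (g * h))

/-- `π` is a unitary representation of `G` on `H`. -/
def IsUnitaryRep [Group G] (π : G → H →L[ℂ] H) : Prop :=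
  (∀ g, (∀ x : H, ‖π g x‖ = ‖x‖) ∧ Function.Surjective (π g)) ∧
  (∀ g h, (π g).comp (π h) = π (g * h))

/-- `ξ` is a Bessel vector for `π`: `∑_g |⟨x, π g ξ⟩|² ≤ B‖x‖²` for all `x ∈ H`
(expressed via finite partial sums). -/
def IsBesselVector (π : G → H →L[ℂ] H) (ξ : H) : Prop :=
  ∃ B : ℝ, 0 < B ∧ ∀ x : H, ∀ s : Finset G, ∑ g ∈ s, ‖⟪x, π g ξ⟫_ℂ‖ ^ 2 ≤ B * ‖x‖ ^ 2

/-- `{π g ξ}_{g ∈ G}` satisfies the frame inequalities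
`A‖x‖² ≤ ∑_g |⟨x, π g ξ⟩|² ≤ B‖x‖²` for all `x` in the set `M`. -/
def IsFrameOn (π : G → H →L[ℂ] H) (ξ : H) (M : Set H) : Prop :=
  ∃ A B : ℝ, 0 < A ∧ A ≤ B ∧ ∀ x ∈ M,
    Summable (fun g : G => ‖⟪x, π g ξ⟫_ℂ‖ ^ 2) ∧
    A * ‖x‖ ^ 2 ≤ ∑' g : G, ‖⟪x, π g ξ⟫_ℂ‖ ^ 2 ∧
    ∑' g : G, ‖⟪x, π g ξ⟫_ℂ‖ ^ 2 ≤ B * ‖x‖ ^ 2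

/-- The closed linear span of the orbit `{π g ξ : g ∈ G}`. -/
def orbitSpan (π : G → H →L[ℂ] H) (ξ : H) : Set H :=
  closure (Submodule.span ℂ (Set.range fun g : G => π g ξ) : Set H)

/-- `{π g ξ}_{g ∈ G}` is a frame sequence: a frame for its closed linear span. -/
def IsFrameSequence (π : G → H →L[ℂ] H) (ξ : H) : Prop :=
  IsFrameOn π ξ (orbitSpan π ξ)

/-- `ξ` is a complete frame vector for `π`: `{π g ξ}_{g ∈ G}` is a frame for `H`. -/
def IsCompleteFrameVector (π : G → H →L[ℂ] H) (ξ : H) : Prop :=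
  IsFrameOn π ξ Set.univ

/-- `{π g ξ}_{g ∈ G}` is a Parseval frame on the set `M`:
`∑_g |⟨x, π g ξ⟩|² = ‖x‖²` for all `x ∈ M`. -/
def IsParsevalFrameOn (π : G → H →L[ℂ] H) (ξ : H) (M : Set H) : Prop :=
  ∀ x ∈ M, HasSum (fun g : G => ‖⟪x, π g ξ⟫_ℂ‖ ^ 2) (‖x‖ ^ 2)

/-- `{π g η}_{g ∈ G}` is a Riesz sequence:
`A ∑ |c g|² ≤ ‖∑ c g • π g η‖² ≤ B ∑ |c g|²` for all finitely supported `c`. -/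
def IsRieszSequence (π : G → H →L[ℂ] H) (η : H) : Prop :=
  ∃ A B : ℝ, 0 < A ∧ A ≤ B ∧ ∀ c : G →₀ ℂ,
    A * ∑ g ∈ c.support, ‖c g‖ ^ 2 ≤ ‖∑ g ∈ c.support, c g • π g η‖ ^ 2 ∧
    ‖∑ g ∈ c.support, c g • π g η‖ ^ 2 ≤ B * ∑ g ∈ c.support, ‖c g‖ ^ 2

/-- The commutant `S' = {T : T A = A T for all A ∈ S}` of a set `S` of operators. -/
def commutant (S : Set (H →L[ℂ] H)) : Set (H →L[ℂ] H) := Set.centralizer S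

/-- `(π, σ)` is a commuting pair: `π(G)' = σ(G)''`. -/
def IsCommutingPair (π σ : G → H →L[ℂ] H) : Prop :=
  commutant (Set.range π) = commutant (commutant (Set.range σ))

end

section BesselVector

variable {G : Type*} {H : Type*} [NormedAddCommGroup H] [InnerProductSpace ℂ H]
  {π : G → H →L[ℂ] H}

/-- The bounded analysis operator `x ↦ (⟨π g ξ, x⟩)_g` of a Bessel vector `ξ`. -/
noncomputable def analysisOp (π : G → H →L[ℂ] H) (ξ : H) (hξ : IsBesselVector π ξ) :
    H →L[ℂ] lp (fun _ : G => ℂ) 2 :=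
  have hmem (x : H) : Memℓp (fun g => ⟪π g ξ, x⟫_ℂ) 2 := by
    obtain ⟨B, -, hB⟩ := hξ
    refine memℓp_gen' (C := B * ‖x‖ ^ 2) fun s => ?_
    simpa [norm_inner_symm x] using hB x s
  LinearMap.mkContinuousOfExistsBound
    { toFun := fun x => ⟨fun g => ⟪π g ξ, x⟫_ℂ, hmem x⟩
      map_add' := fun x y => by ext g; exact inner_add_right ..
      map_smul' := fun c x => by ext g; simp } (by
    obtain ⟨B, hB0, hB⟩ := hξ
    refine ⟨√B, fun x => lp.norm_le_of_forall_sum_le (by simp) (by positivity) fun s => ?_⟩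
    simpa [norm_inner_symm x, mul_pow, hB0.le] using hB x s)

@[simp]
lemma analysisOp_apply {ξ : H} (hξ : IsBesselVector π ξ) (x : H) (g : G) :
    analysisOp π ξ hξ x g = ⟪π g ξ, x⟫_ℂ := rfl

lemma hasSum_analysisOp {ξ : H} (hξ : IsBesselVector π ξ) (x : H) :
    HasSum (fun g => ‖⟪x, π g ξ⟫_ℂ‖ ^ 2) (‖analysisOp π ξ hξ x‖ ^ 2) := by
  have h := lp.hasSum_norm (p := 2) (by simp) (analysisOp π ξ hξ x)
  simpa [norm_inner_symm x] using h

lemma isBesselVector_of_hasSum_le {ξ : H} {B : ℝ} {f : H → ℝ}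
    (hsum : ∀ x, HasSum (fun g => ‖⟪x, π g ξ⟫_ℂ‖ ^ 2) (f x)) (hB : ∀ x, f x ≤ B * ‖x‖ ^ 2) :
    IsBesselVector π ξ := by
  refine ⟨max B 1, by positivity, fun x s => ?_⟩
  calc _ ≤ f x := sum_le_hasSum s (fun _ _ => by positivity) (hsum x)
    _ ≤ B * ‖x‖ ^ 2 := hB x
    _ ≤ _ := by gcongr; exact le_max_left ..

lemma IsParsevalFrameOn.isBesselVector {ξ : H} (hξ : IsParsevalFrameOn π ξ Set.univ) :
    IsBesselVector π ξ :=
  isBesselVector_of_hasSum_le (B := 1) (fun x => hξ x trivial) (by simp)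

lemma IsFrameOn.isBesselVector {ξ : H} (hξ : IsFrameOn π ξ Set.univ) :
    IsBesselVector π ξ := by
  obtain ⟨A, B, -, -, h⟩ := hξ
  exact isBesselVector_of_hasSum_le (fun x => (h x trivial).1.hasSum) fun x => (h x trivial).2.2

lemma IsBesselVector.add {x y : H} (hx : IsBesselVector π x) (hy : IsBesselVector π y) :
    IsBesselVector π (x + y) := by
  obtain ⟨A, hA, hx⟩ := hx
  obtain ⟨B, hB, hy⟩ := hy
  refine ⟨2 * A + 2 * B, by positivity, fun z s => ?_⟩
  calc _ ≤ ∑ g ∈ s, (2 * ‖⟪z, π g x⟫_ℂ‖ ^ 2 + 2 * ‖⟪z, π g y⟫_ℂ‖ ^ 2) := by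
        refine Finset.sum_le_sum fun g _ => ?_
        rw [map_add, inner_add_right]
        have := norm_add_le ⟪z, π g x⟫_ℂ ⟪z, π g y⟫_ℂ
        have h2 := sq_nonneg (‖⟪z, π g x⟫_ℂ‖ - ‖⟪z, π g y⟫_ℂ‖)
        have := pow_le_pow_left₀ (norm_nonneg _) this 2
        nlinarith
    _ ≤ _ := by
        rw [Finset.sum_add_distrib, ← Finset.mul_sum, ← Finset.mul_sum]
        linarith [hx z s, hy z s]

lemma IsBesselVector.smul {x : H} (hx : IsBesselVector π x) (c : ℂ) :
    IsBesselVector π (c • x) := by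
  obtain ⟨A, hA, hx⟩ := hx
  refine ⟨(‖c‖ ^ 2 + 1) * A, by positivity, fun z s => ?_⟩
  simp only [map_smul, inner_smul_right, norm_mul, mul_pow, ← Finset.mul_sum]
  have := hx z s
  have h0 : 0 ≤ ∑ g ∈ s, ‖⟪z, π g x⟫_ℂ‖ ^ 2 := by positivity
  nlinarith [sq_nonneg ‖c‖]

lemma IsBesselVector.zero : IsBesselVector π (0 : H) :=
  ⟨1, one_pos, fun x s => by simp⟩

lemma commute_of_mem_bicommutant {A S : H →L[ℂ] H}
    (hA : A ∈ commutant (commutant (Set.range π))) (hS : S ∈ commutant (Set.range π)) (x : H) :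
    A (S x) = S (A x) :=
  (congrArg (fun T : H →L[ℂ] H => T x) (hA S hS)).symm

end BesselVector

section ProjUnitaryRep

variable {G : Type*} [Group G] {H : Type*} [NormedAddCommGroup H] [InnerProductSpace ℂ H]
  {mu : G → G → ℂ} {π : G → H →L[ℂ] H}

namespace IsProjUnitaryRep

lemma inner_map_map (hπ : IsProjUnitaryRep mu π) (g : G) (x y : H) :
    ⟪π g x, π g y⟫_ℂ = ⟪x, y⟫_ℂ :=
  (LinearIsometry.mk (π g).toLinearMap (hπ.2.1 g).1).inner_map_map x y

lemma map_map (hπ : IsProjUnitaryRep mu π) (g h : G) (x : H) :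
    π g (π h x) = mu g h • π (g * h) x :=
  congrArg (fun T : H →L[ℂ] H => T x) (hπ.2.2 g h)

lemma map_one_apply (hπ : IsProjUnitaryRep mu π) (x : H) : π 1 x = mu 1 1 • x := by
  have hinj : Function.Injective (π 1) :=
    (LinearIsometry.mk (π 1).toLinearMap (hπ.2.1 1).1).injective
  apply hinj
  rw [hπ.map_map, mul_one, map_smul]

lemma exists_inner_map_right (hπ : IsProjUnitaryRep mu π) (g : G) :
    ∃ c : ℂ, ‖c‖ = 1 ∧ ∀ x y : H, ⟪x, π g y⟫_ℂ = c * ⟪π g⁻¹ x, y⟫_ℂ := by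
  refine ⟨mu g⁻¹ g * mu 1 1, by simp [hπ.1], fun x y => ?_⟩
  rw [← hπ.inner_map_map g⁻¹, hπ.map_map, inv_mul_cancel, hπ.map_one_apply, inner_smul_right,
    inner_smul_right, mul_assoc]

lemma norm_inner_map_right (hπ : IsProjUnitaryRep mu π) (g : G) (x y : H) :
    ‖⟪x, π g y⟫_ℂ‖ = ‖⟪y, π g⁻¹ x⟫_ℂ‖ := by
  obtain ⟨c, hc, h⟩ := hπ.exists_inner_map_right g
  rw [h, norm_mul, hc, one_mul, norm_inner_symm]

lemma hasSum_norm_inner_swap (hπ : IsProjUnitaryRep mu π) {x y : H} {s : ℝ}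
    (h : HasSum (fun g => ‖⟪x, π g y⟫_ℂ‖ ^ 2) s) :
    HasSum (fun g => ‖⟪y, π g x⟫_ℂ‖ ^ 2) s := by
  simp only [hπ.norm_inner_map_right _ x y] at h
  exact (Equiv.inv G).hasSum_iff.mp h

end IsProjUnitaryRep

lemma IsBesselVector.map (hπ : IsProjUnitaryRep mu π) {x : H} (hx : IsBesselVector π x) (h : G) :
    IsBesselVector π (π h x) := by
  obtain ⟨A, hA, hx⟩ := hx
  refine ⟨A, hA, fun z s => ?_⟩
  classical
  have := hx z (s.image (· * h))
  rw [Finset.sum_image (fun a _ b _ hab => mul_right_cancel hab)] at this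
  simpa [hπ.map_map, inner_smul_right, hπ.1] using this

/-- The vectors which are Bessel for `π` form a dense set as soon as `π` has a Parseval vector. -/
lemma dense_isBesselVector [CompleteSpace H] (hπ : IsProjUnitaryRep mu π) {ξ : H}
    (hξ : IsParsevalFrameOn π ξ Set.univ) : Dense {x : H | IsBesselVector π x} := by
  let E : Submodule ℂ H :=
    { carrier := {x | IsBesselVector π x}
      add_mem' := fun hx hy => IsBesselVector.add hx hy
      zero_mem' := IsBesselVector.zero
      smul_mem' := fun c x hx => IsBesselVector.smul hx c }
  have hE : Eᗮ = ⊥ := by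
    refine (Submodule.eq_bot_iff _).mpr fun x hx => ?_
    have h (g : G) : ⟪x, π g ξ⟫_ℂ = 0 :=
      Submodule.inner_left_of_mem_orthogonal (hξ.isBesselVector.map hπ g : π g ξ ∈ E) hx
    have hx0 := hξ x trivial
    simp only [h, norm_zero, ne_eq, OfNat.ofNat_ne_zero, not_false_eq_true, zero_pow] at hx0
    simpa using hx0.unique hasSum_zero
  exact Submodule.dense_iff_topologicalClosure_eq_top.mpr
    (Submodule.topologicalClosure_eq_top_iff.mpr hE)

namespace IsProjUnitaryRep

lemma inner_analysisOp_map (hπ : IsProjUnitaryRep mu π) {x y : H} (hx : IsBesselVector π x)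
    (hy : IsBesselVector π y) (h : G) (a b : H) :
    ⟪analysisOp π x hx (π h a), analysisOp π y hy (π h b)⟫_ℂ =
      ⟪analysisOp π x hx a, analysisOp π y hy b⟫_ℂ := by
  have h1 := lp.hasSum_inner (𝕜 := ℂ) (analysisOp π x hx (π h a)) (analysisOp π y hy (π h b))
  rw [← (Equiv.mulLeft h).hasSum_iff] at h1
  refine h1.unique ?_
  convert lp.hasSum_inner (𝕜 := ℂ) (analysisOp π x hx a) (analysisOp π y hy b) using 2 with g
  have hg (x a : H) : ⟪π g x, a⟫_ℂ = star (mu h g) * ⟪π (h * g) x, π h a⟫_ℂ := by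
    rw [← hπ.inner_map_map h, hπ.map_map, inner_smul_left]
    rfl
  have hmu : mu h g * star (mu h g) = 1 := by
    rw [Complex.star_def, Complex.mul_conj']
    simp [hπ.1]
  simp only [Function.comp_apply, Equiv.coe_mulLeft, analysisOp_apply, hg, RCLike.inner_apply,
    map_mul, Complex.star_def, Complex.conj_conj]
  rw [Complex.star_def] at hmu
  linear_combination (-(⟪π (h * g) y, π h b⟫_ℂ *
    (starRingEnd ℂ) ⟪π (h * g) x, π h a⟫_ℂ)) * hmu

end IsProjUnitaryRep

section Commutant

variable [CompleteSpace H]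

namespace IsProjUnitaryRep

lemma star_mem_commutant (hπ : IsProjUnitaryRep mu π) {T : H →L[ℂ] H}
    (hT : T ∈ commutant (Set.range π)) : star T ∈ commutant (Set.range π) := by
  rintro _ ⟨g, rfl⟩
  obtain ⟨c, -, hc⟩ := hπ.exists_inner_map_right g
  have hstar : star (π g) = star c • π g⁻¹ := by
    ext x
    refine ext_inner_right ℂ fun y => ?_
    rw [ContinuousLinearMap.star_eq_adjoint, ContinuousLinearMap.adjoint_inner_left, hc]
    simp [inner_smul_left]
  have hcomm : Commute (star (π g)) T := by
    rw [hstar]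
    exact Commute.smul_left (hT _ ⟨g⁻¹, rfl⟩) _
  simpa using hcomm.star_star.eq

lemma star_mem_bicommutant (hπ : IsProjUnitaryRep mu π) {A : H →L[ℂ] H}
    (hA : A ∈ commutant (commutant (Set.range π))) :
    star A ∈ commutant (commutant (Set.range π)) :=
  Set.star_mem_centralizer' (fun _ => hπ.star_mem_commutant) hA

lemma adjoint_analysisOp_comp_mem (hπ : IsProjUnitaryRep mu π) {x y : H}
    (hx : IsBesselVector π x) (hy : IsBesselVector π y) :
    (analysisOp π y hy).adjoint ∘L analysisOp π x hx ∈ commutant (Set.range π) := by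
  rintro _ ⟨g, rfl⟩
  ext a
  refine ext_inner_right ℂ fun b => ?_
  obtain ⟨b, rfl⟩ := (hπ.2.1 g).2 b
  simp [hπ.inner_map_map, ContinuousLinearMap.adjoint_inner_left, hπ.inner_analysisOp_map]

end IsProjUnitaryRep

/-- The square root of `star B * B`. -/
lemma exists_nonneg_mul_self {K : Type*} [NormedAddCommGroup K] [InnerProductSpace ℂ K]
    [CompleteSpace K] (B : H →L[ℂ] K) :
    ∃ S : H →L[ℂ] H, 0 ≤ S ∧ S * S = B.adjoint ∘L B ∧ (∀ z, ‖S z‖ = ‖B z‖) ∧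
      ∀ T : H →L[ℂ] H, Commute (B.adjoint ∘L B) T → Commute S T := by
  have hpos : 0 ≤ B.adjoint ∘L B := by
    rw [ContinuousLinearMap.nonneg_iff_isPositive]
    exact ContinuousLinearMap.isPositive_adjoint_comp_self B
  have hsa : IsSelfAdjoint (CFC.sqrt (B.adjoint ∘L B)) := (CFC.sqrt_nonneg _).isSelfAdjoint
  have hmul := CFC.sqrt_mul_sqrt_self _ hpos
  refine ⟨CFC.sqrt (B.adjoint ∘L B), CFC.sqrt_nonneg _, hmul, fun z => ?_, fun T hT => ?_⟩
  · have h : ⟪CFC.sqrt (B.adjoint ∘L B) z, CFC.sqrt (B.adjoint ∘L B) z⟫_ℂ = ⟪B z, B z⟫_ℂ := by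
      rw [← ContinuousLinearMap.adjoint_inner_left, ← ContinuousLinearMap.star_eq_adjoint,
        hsa.star_eq, ← mul_apply_eq_comp, hmul, ContinuousLinearMap.comp_apply,
        ContinuousLinearMap.adjoint_inner_left]
    rw [inner_self_eq_norm_sq_to_K, inner_self_eq_norm_sq_to_K] at h
    exact (pow_left_inj₀ (norm_nonneg _) (norm_nonneg _) two_ne_zero).mp (by exact_mod_cast h)
  · rw [CFC.sqrt_eq_cfc]
    exact hT.cfc_nnreal _

end Commutant

end ProjUnitaryRep

section PartialIsometry

variable {H : Type*} [NormedAddCommGroup H] [InnerProductSpace ℂ H] [CompleteSpace H]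

/-- A set of pairs of vectors with matching matrix coefficients for all operators in `M`; such a
set generates a partial isometry commuting with `M`. -/
def HasEqualCoeffs (M : Set (H →L[ℂ] H)) (P : Set (H × H)) : Prop :=
  ∀ S ∈ M, ∀ p ∈ P, ∀ q ∈ P, ⟪S p.1, q.1⟫_ℂ = ⟪S p.2, q.2⟫_ℂ

lemma inner_apply_left_eq_star (S : H →L[ℂ] H) (x y : H) :
    ⟪S x, y⟫_ℂ = ⟪x, star S y⟫_ℂ := by
  rw [ContinuousLinearMap.star_eq_adjoint, ContinuousLinearMap.adjoint_inner_right]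

lemma inner_star_apply_left (S : H →L[ℂ] H) (x y : H) :
    ⟪star S x, y⟫_ℂ = ⟪x, S y⟫_ℂ := by
  rw [inner_apply_left_eq_star, star_star]

variable {M : Set (H →L[ℂ] H)}

lemma HasEqualCoeffs.insert (hstar : ∀ S ∈ M, star S ∈ M) {P : Set (H × H)}
    (hP : HasEqualCoeffs M P) {x : H × H}
    (hxP : ∀ S ∈ M, ∀ p ∈ P, ⟪S x.1, p.1⟫_ℂ = ⟪S x.2, p.2⟫_ℂ)
    (hx : ∀ S ∈ M, ⟪S x.1, x.1⟫_ℂ = ⟪S x.2, x.2⟫_ℂ) :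
    HasEqualCoeffs M (insert x P) := by
  rintro S hS p (rfl | hp) q (rfl | hq)
  · exact hx S hS
  · exact hxP S hS q hq
  · have h := hxP _ (hstar S hS) p hp
    rw [inner_star_apply_left, inner_star_apply_left] at h
    rw [← inner_conj_symm, h, inner_conj_symm]
  · exact hP S hS p hp q hq

lemma exists_maximal_hasEqualCoeffs (hstar : ∀ S ∈ M, star S ∈ M) {ξ η : H}
    (h : ∀ S ∈ M, ⟪S ξ, ξ⟫_ℂ = ⟪S η, η⟫_ℂ) :
    ∃ P : Set (H × H), (ξ, η) ∈ P ∧ HasEqualCoeffs M P ∧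
      ∀ x : H × H, (∀ S ∈ M, ∀ p ∈ P, ⟪S x.1, p.1⟫_ℂ = ⟪S x.2, p.2⟫_ℂ) →
        (∀ S ∈ M, ⟪S x.1, x.1⟫_ℂ = ⟪S x.2, x.2⟫_ℂ) → x ∈ P := by
  obtain ⟨P, hξP, hmax⟩ := zorn_subset_nonempty {P | HasEqualCoeffs M P} (fun c hc hchain _ =>
    ⟨⋃₀ c, fun S hS p ⟨s, hs, hps⟩ q ⟨t, ht, hqt⟩ => by
      rcases hchain.total hs ht with hst | hst
      · exact hc ht S hS p (hst hps) q hqt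
      · exact hc hs S hS p hps q (hst hqt), fun s => Set.subset_sUnion_of_mem⟩)
    {(ξ, η)} (by rintro S hS p rfl q rfl; exact h S hS)
  refine ⟨P, hξP rfl, hmax.prop, fun x hxP hx => ?_⟩
  exact hmax.le_of_ge (hmax.prop.insert hstar hxP hx) (Set.subset_insert ..)
    (Set.mem_insert ..)

/-- If the vector states of `ξ` and `η` agree on a self-adjoint multiplicative set `M`, there is a
partial isometry `w` in the commutant of `M` taking `ξ` to `η`, which is maximal in the sense that
no nonzero operator of the commutant maps the kernel of `w` into the kernel of `star w`. -/
lemma exists_maximal_partialIsometry (h_one : 1 ∈ M) (hmul : ∀ S ∈ M, ∀ T ∈ M, S * T ∈ M)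
    (hstar : ∀ S ∈ M, star S ∈ M) {ξ η : H} (h : ∀ S ∈ M, ⟪S ξ, ξ⟫_ℂ = ⟪S η, η⟫_ℂ) :
    ∃ w ∈ commutant M, w ξ = η ∧ w * (star w * w) = w ∧
      ∀ b ∈ commutant M, b * star w = 0 → star w * b = 0 → b = 0 := by
  obtain ⟨P₀, hξη, hP, hmax⟩ := exists_maximal_hasEqualCoeffs hstar h
  let P : Submodule ℂ (H × H) :=
    { carrier := P₀
      add_mem' := fun {a b} ha hb => by
        refine hmax _ (fun S hS p hp => ?_) (fun S hS => ?_)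
        · simp [hP S hS a ha p hp, hP S hS b hb p hp]
        · simp [hP S hS a ha a ha, hP S hS b hb b hb,
            hP S hS a ha b hb, hP S hS b hb a ha]
      zero_mem' := hmax _ (by simp) (by simp)
      smul_mem' := fun c a ha => by
        refine hmax _ (fun S hS p hp => ?_) (fun S hS => ?_)
        · simp [hP S hS a ha p hp]
        · simp [hP S hS a ha a ha] }
  have hinv (S : H →L[ℂ] H) (hS : S ∈ M) (p : H × H) (hp : p ∈ P) : (S p.1, S p.2) ∈ P := by
    refine hmax _ (fun T hT q hq => hP _ (hmul T hT S hS) p hp q hq) (fun T hT => ?_)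
    have := hP _ (hmul _ (hstar S hS) _ (hmul T hT S hS)) p hp p hp
    simpa [inner_star_apply_left] using this
  have hclosed : IsClosed (P : Set (H × H)) := by
    refine isClosed_of_closure_subset fun x hx => hmax x (fun S hS p hp => ?_) fun S hS => ?_
    · exact closure_minimal (t := {x : H × H | ⟪S x.1, p.1⟫_ℂ = ⟪S x.2, p.2⟫_ℂ})
        (fun q hq => hP S hS q hq p hp) (isClosed_eq (by fun_prop) (by fun_prop)) hx
    · exact closure_minimal (t := {x : H × H | ⟪S x.1, x.1⟫_ℂ = ⟪S x.2, x.2⟫_ℂ})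
        (fun q hq => hP S hS q hq q hq) (isClosed_eq (by fun_prop) (by fun_prop)) hx
  have : CompleteSpace P := hclosed.completeSpace_coe
  have hinner (p : H × H) (hp : p ∈ P) (q : H × H) (hq : q ∈ P) :
      ⟪p.1, q.1⟫_ℂ = ⟪p.2, q.2⟫_ℂ := hP 1 h_one p hp q hq
  have hnorm (p : H × H) (hp : p ∈ P) : ‖p.1‖ = ‖p‖ := by
    have h2 := hinner p hp p hp
    rw [inner_self_eq_norm_sq_to_K, inner_self_eq_norm_sq_to_K] at h2
    have h3 : ‖p.1‖ = ‖p.2‖ :=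
      (pow_left_inj₀ (norm_nonneg _) (norm_nonneg _) two_ne_zero).mp (by exact_mod_cast h2)
    rw [Prod.norm_def, ← h3, max_self]
  let L : P →ₗᵢ[ℂ] H :=
    { toLinearMap := LinearMap.fst ℂ H H ∘ₗ P.subtype
      norm_map' := fun p => hnorm p p.2 }
  let K : Submodule ℂ H := LinearMap.range L.toLinearMap
  have : CompleteSpace K := L.equivRange.toIsometryEquiv.completeSpace_iff.mp ‹_›
  have hK (z : H) : ∃ p ∈ P, z - p.1 ∈ Kᗮ := by
    obtain ⟨p, hp⟩ := (K.orthogonalProjectionOnto z).2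
    refine ⟨p, p.2, ?_⟩
    have hp' : (p : H × H).1 = K.orthogonalProjectionOnto z := hp
    rw [hp']
    exact K.sub_starProjection_mem_orthogonal z
  let w : H →L[ℂ] H := ContinuousLinearMap.snd ℂ H H ∘L P.subtypeL ∘L
    (L.equivRange.symm.toContinuousLinearEquiv : K →L[ℂ] P) ∘L K.orthogonalProjectionOnto
  have hwK (z : H) (hz : z ∈ Kᗮ) : w z = 0 := by
    simp [w, Submodule.orthogonalProjectionOnto_apply_of_mem_orthogonal hz]
  have hwP (p : H × H) (hp : p ∈ P) : w p.1 = p.2 := by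
    have h1 : K.orthogonalProjectionOnto p.1 = L.equivRange ⟨p, hp⟩ :=
      K.orthogonalProjectionOnto_mem_subspace_eq_self (L.equivRange ⟨p, hp⟩)
    simp [w, h1]
  have hKorth (z : H) (hz : z ∈ Kᗮ) (p : H × H) (hp : p ∈ P) : ⟪p.1, z⟫_ℂ = 0 :=
    hz p.1 ⟨⟨p, hp⟩, rfl⟩
  have hwstar (p : H × H) (hp : p ∈ P) : star w p.2 = p.1 := by
    refine ext_inner_right ℂ fun z => ?_
    obtain ⟨q, hq, hz⟩ := hK z
    obtain ⟨z, rfl⟩ : ∃ z', z = q.1 + z' := ⟨z - q.1, by simp⟩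
    rw [add_sub_cancel_left] at hz
    rw [inner_star_apply_left, map_add, hwP q hq, hwK z hz, add_zero, inner_add_right,
      hKorth z hz p hp, add_zero, hinner p hp q hq]
  have hwmem : w ∈ commutant M := by
    intro S hS
    ext z
    obtain ⟨q, hq, hz⟩ := hK z
    obtain ⟨z, rfl⟩ : ∃ z', z = q.1 + z' := ⟨z - q.1, by simp⟩
    rw [add_sub_cancel_left] at hz
    have hSz : S z ∈ Kᗮ := by
      rintro _ ⟨p, rfl⟩
      change ⟪(p : H × H).1, S z⟫_ℂ = 0
      rw [← inner_star_apply_left]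
      exact hKorth z hz _ (hinv _ (hstar S hS) p p.2)
    simp only [mul_apply_eq_comp, map_add]
    rw [hwP q hq, hwK z hz, hwP _ (hinv S hS q hq), hwK _ hSz, map_zero]
  have hwww : w * (star w * w) = w := by
    ext z
    obtain ⟨q, hq, hz⟩ := hK z
    obtain ⟨z, rfl⟩ : ∃ z', z = q.1 + z' := ⟨z - q.1, by simp⟩
    rw [add_sub_cancel_left] at hz
    simp only [mul_apply_eq_comp, map_add]
    rw [hwP q hq, hwK z hz, hwstar q hq, hwP q hq, map_zero, map_zero]
  refine ⟨w, hwmem, hwP _ hξη, hwww, fun b hb hbw hwb => ?_⟩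
  obtain ⟨S, hS0, hSS, hSb, hcomm⟩ := exists_nonneg_mul_self b
  have hSsa : IsSelfAdjoint S := hS0.isSelfAdjoint
  have hS (T : H →L[ℂ] H) (hT : T ∈ M) (z : H) : S (T z) = T (S z) := by
    refine congrArg (fun R : H →L[ℂ] H => R z) (hcomm T ?_)
    exact (Set.mul_mem_centralizer (Set.star_mem_centralizer' hstar hb) hb T hT).symm
  have happly {a : H →L[ℂ] H} (ha : a ∈ commutant M) {T : H →L[ℂ] H} (hT : T ∈ M) (z : H) :
      T (a z) = a (T z) := congrArg (fun R : H →L[ℂ] H => R z) (ha T hT)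
  have hw' : star w ∈ commutant M := Set.star_mem_centralizer' hstar hwmem
  have hSw : S * star w = 0 := by
    ext z
    have := hSb (star w z)
    rw [← mul_apply_eq_comp b, hbw, zero_apply, norm_zero, norm_eq_zero] at this
    simpa using this
  have hwS : w * S = 0 := by
    have := congrArg star hSw
    rwa [star_mul, star_star, hSsa.star_eq, star_zero] at this
  have hmem (v : H) : (S v, b v) ∈ P := by
    refine hmax _ (fun T hT p hp => ?_) (fun T hT => ?_)
    · have h1 : ⟪T (S v), p.1⟫_ℂ = 0 := by
        rw [← hwstar p hp, ← star_star w, ← inner_apply_left_eq_star, star_star,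
          ← happly hwmem hT, ← mul_apply_eq_comp w, hwS]
        simp
      have h2 : ⟪T (b v), p.2⟫_ℂ = 0 := by
        rw [← hwP p hp, ← inner_star_apply_left, ← happly hw' hT,
          ← mul_apply_eq_comp (star w), hwb]
        simp
      exact h1.trans h2.symm
    · change ⟪T (S v), S v⟫_ℂ = ⟪T (b v), b v⟫_ℂ
      rw [happly hb hT, ← hS T hT, inner_apply_left_eq_star, hSsa.star_eq, ← mul_apply_eq_comp S,
        hSS, ContinuousLinearMap.comp_apply, ContinuousLinearMap.adjoint_inner_right]
  ext v
  exact (hwP _ (hmem v)).symm.trans (congrArg (fun R : H →L[ℂ] H => R v) hwS)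

end PartialIsometry

/-- A positive invertible element `S` is, up to scaling and translation, the real part of a
unitary commuting with everything that commutes with `S`. -/
lemma exists_unitary_of_isUnit_nonneg {A : Type*} [CStarAlgebra A] [PartialOrder A]
    [StarOrderedRing A] {S : A} (hS0 : 0 ≤ S) (hSu : IsUnit S) :
    ∃ a b : ℝ, 0 < b ∧ b < a ∧ ∃ u ∈ unitary A,
      S = (a : ℂ) • 1 + ((b / 2 : ℝ) : ℂ) • (u + star u) ∧
      ∀ T : A, Commute S T → Commute u T := by
  have hsa : IsSelfAdjoint S := hS0.isSelfAdjoint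
  obtain ⟨r, hr, hrS⟩ : ∃ r > 0, algebraMap ℝ A r ≤ S := by
    cases subsingleton_or_nontrivial A
    · exact ⟨1, one_pos, (Subsingleton.elim _ _).le⟩
    · exact (CFC.exists_pos_algebraMap_le_iff hsa).mpr fun x hx =>
        (hSu.isStrictlyPositive hS0).spectrum_pos hx
  have ha0 : 0 ≤ algebraMap ℝ A (‖S‖ + r) - S := by
    rw [map_add, sub_nonneg]
    exact le_add_of_le_of_nonneg hsa.le_algebraMap_norm_self (algebraMap_nonneg _ hr.le)
  have hnorm : ‖S - algebraMap ℝ A (‖S‖ + r)‖ ≤ ‖S‖ + r / 2 := by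
    rw [norm_sub_rev, CStarAlgebra.norm_le_iff_le_algebraMap _ (by positivity) ha0,
      sub_le_iff_le_add, map_add, map_add, add_assoc]
    gcongr
    exact le_add_of_nonneg_of_le (algebraMap_nonneg _ (by positivity)) hrS
  have hb : 0 < ‖S‖ + r / 2 := by positivity
  generalize hb' : ‖S‖ + r / 2 = b at hnorm hb
  generalize ha' : ‖S‖ + r = a at hnorm
  let Y : selfAdjoint A := ⟨b⁻¹ • (S - algebraMap ℝ A a),
    IsSelfAdjoint.smul (.all b⁻¹) (hsa.sub (.algebraMap _ (.all a)))⟩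
  have hY : ‖Y‖ ≤ 1 := by
    change ‖b⁻¹ • (S - algebraMap ℝ A a)‖ ≤ 1
    rw [norm_smul, norm_inv, Real.norm_of_nonneg hb.le]
    exact inv_mul_le_one_of_le₀ hnorm hb.le
  refine ⟨a, b, hb, by linarith, _, (selfAdjoint.unitarySelfAddISMul Y hY).2, ?_, fun T hT => ?_⟩
  · rw [selfAdjoint.star_coe_unitarySelfAddISMul]
    change S = (a : ℂ) • 1 + ((b / 2 : ℝ) : ℂ) • ((Y : A) + _ + _)
    rw [add_add_sub_cancel, ← two_smul ℂ, smul_smul]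
    have hb2 : ((b / 2 : ℝ) : ℂ) * 2 = ((b : ℝ) : ℂ) := by push_cast; ring
    have hbY : b • (Y : A) = S - algebraMap ℝ A a := smul_inv_smul₀ hb.ne' _
    rw [hb2, Complex.coe_smul, Complex.coe_smul, hbY, ← Algebra.algebraMap_eq_smul_one,
      add_sub_cancel]
  · have hYT : Commute (Y : A) T :=
      (hT.sub_left (Algebra.commute_algebraMap_left a T)).smul_left _
    refine hYT.add_left (.smul_left ?_ _)
    rw [CFC.sqrt_eq_cfc]
    exact .cfc_nnreal ((Commute.one_left T).sub_left (hYT.pow_left 2)) _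

section FrameVectors

variable {G : Type*} [Group G] {H : Type*} [NormedAddCommGroup H] [InnerProductSpace ℂ H]
  [CompleteSpace H] {mu : G → G → ℂ} {π : G → H →L[ℂ] H}

namespace IsProjUnitaryRep

/-- For a Bessel vector `x`, the coefficients of `x` against the orbit of `A ξ`, where `A` lies in
the bicommutant, have `ℓ²`-norm `‖A z‖` for a vector `z` of norm `‖x‖` not depending on `A`. -/
lemma exists_hasSum_norm_inner (hπ : IsProjUnitaryRep mu π) {ξ : H}
    (hξ : IsParsevalFrameOn π ξ Set.univ) {x : H} (hx : IsBesselVector π x) :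
    ∃ z : H, ‖z‖ = ‖x‖ ∧ ∀ A ∈ commutant (commutant (Set.range π)),
      HasSum (fun g => ‖⟪x, π g (A ξ)⟫_ℂ‖ ^ 2) (‖A z‖ ^ 2) := by
  obtain ⟨S, -, -, hS, hcomm⟩ := exists_nonneg_mul_self (analysisOp π x hx)
  have hSmem : S ∈ commutant (Set.range π) := fun T hT =>
    (hcomm T (hπ.adjoint_analysisOp_comp_mem hx hx T hT).symm).symm
  refine ⟨S ξ, ?_, fun A hA => ?_⟩
  · rw [hS]
    refine (pow_left_inj₀ (norm_nonneg _) (norm_nonneg _) two_ne_zero).mp ?_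
    exact (hasSum_analysisOp hx ξ).unique (hπ.hasSum_norm_inner_swap (hξ x trivial))
  · rw [commute_of_mem_bicommutant hA hSmem, hS]
    exact hπ.hasSum_norm_inner_swap (hasSum_analysisOp hx (A ξ))

/-- If `A` in the bicommutant is bounded by `C`, then `C ^ 2` is a Bessel bound for `A ξ`. -/
lemma sum_norm_inner_le (hπ : IsProjUnitaryRep mu π) {ξ : H}
    (hξ : IsParsevalFrameOn π ξ Set.univ) {A : H →L[ℂ] H}
    (hA : A ∈ commutant (commutant (Set.range π))) {C : ℝ} (hAC : ∀ z, ‖A z‖ ≤ C * ‖z‖)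
    (x : H) (s : Finset G) : ∑ g ∈ s, ‖⟪x, π g (A ξ)⟫_ℂ‖ ^ 2 ≤ C ^ 2 * ‖x‖ ^ 2 := by
  have hcl : IsClosed {x : H | ∑ g ∈ s, ‖⟪x, π g (A ξ)⟫_ℂ‖ ^ 2 ≤ C ^ 2 * ‖x‖ ^ 2} :=
    isClosed_le (by fun_prop) (by fun_prop)
  refine hcl.closure_subset_iff.mpr (fun y hy => ?_) (dense_isBesselVector hπ hξ x)
  obtain ⟨z, hz, hzA⟩ := hπ.exists_hasSum_norm_inner hξ hy
  calc _ ≤ ‖A z‖ ^ 2 := sum_le_hasSum s (fun _ _ => by positivity) (hzA A hA)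
    _ ≤ (C * ‖z‖) ^ 2 := by gcongr; exact hAC z
    _ = C ^ 2 * ‖y‖ ^ 2 := by rw [mul_pow, hz]

lemma isBesselVector_bicommutant (hπ : IsProjUnitaryRep mu π) {ξ : H}
    (hξ : IsParsevalFrameOn π ξ Set.univ) {A : H →L[ℂ] H}
    (hA : A ∈ commutant (commutant (Set.range π))) : IsBesselVector π (A ξ) :=
  ⟨‖A‖ ^ 2 + 1, by positivity, fun x s =>
    (hπ.sum_norm_inner_le hξ hA A.le_opNorm x s).trans (by gcongr; simp)⟩

lemma norm_analysisOp_le (hπ : IsProjUnitaryRep mu π) {ξ : H}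
    (hξ : IsParsevalFrameOn π ξ Set.univ) {A : H →L[ℂ] H}
    (hA : A ∈ commutant (commutant (Set.range π))) {C : ℝ} (hC : 0 ≤ C)
    (hAC : ∀ z, ‖A z‖ ≤ C * ‖z‖) (x : H) :
    ‖analysisOp π (A ξ) (hπ.isBesselVector_bicommutant hξ hA) x‖ ≤ C * ‖x‖ := by
  refine (pow_le_pow_iff_left₀ (norm_nonneg _) (by positivity) two_ne_zero).mp ?_
  rw [mul_pow]
  exact hasSum_le_of_sum_le (hasSum_analysisOp _ x) (hπ.sum_norm_inner_le hξ hA hAC x)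

lemma le_norm_analysisOp (hπ : IsProjUnitaryRep mu π) {ξ : H}
    (hξ : IsParsevalFrameOn π ξ Set.univ) {A : H →L[ℂ] H}
    (hA : A ∈ commutant (commutant (Set.range π))) {c : ℝ} (hc : 0 ≤ c)
    (hAc : ∀ z, c * ‖z‖ ≤ ‖A z‖) (x : H) :
    c * ‖x‖ ≤ ‖analysisOp π (A ξ) (hπ.isBesselVector_bicommutant hξ hA) x‖ := by
  have hcl : IsClosed {x : H | c * ‖x‖ ≤
      ‖analysisOp π (A ξ) (hπ.isBesselVector_bicommutant hξ hA) x‖} :=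
    isClosed_le (by fun_prop) (by fun_prop)
  refine hcl.closure_subset_iff.mpr (fun y hy => ?_) (dense_isBesselVector hπ hξ x)
  obtain ⟨z, hz, hzA⟩ := hπ.exists_hasSum_norm_inner hξ hy
  refine (pow_le_pow_iff_left₀ (by positivity) (norm_nonneg _) two_ne_zero).mp ?_
  rw [(hasSum_analysisOp _ y).unique (hzA A hA), ← hz]
  gcongr
  exact hAc z

lemma isParsevalFrameOn_unitary (hπ : IsProjUnitaryRep mu π) {ξ : H}
    (hξ : IsParsevalFrameOn π ξ Set.univ) {U : H →L[ℂ] H}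
    (hU : U ∈ commutant (commutant (Set.range π))) (hUu : U ∈ unitary (H →L[ℂ] H)) :
    IsParsevalFrameOn π (U ξ) Set.univ := fun x _ => by
  have hnorm (z : H) : ‖U z‖ = ‖z‖ := ContinuousLinearMap.norm_map_of_mem_unitary hUu z
  have h1 := hπ.norm_analysisOp_le hξ hU zero_le_one (fun z => by simp [hnorm]) x
  have h2 := hπ.le_norm_analysisOp hξ hU zero_le_one (fun z => by simp [hnorm]) x
  rw [one_mul] at h1 h2
  rw [h2.antisymm h1]
  exact hasSum_analysisOp _ x

lemma isFrameOn_isUnit (hπ : IsProjUnitaryRep mu π) {ξ : H}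
    (hξ : IsParsevalFrameOn π ξ Set.univ) {U : H →L[ℂ] H}
    (hU : U ∈ commutant (commutant (Set.range π))) (hUu : IsUnit U) :
    IsFrameOn π (U ξ) Set.univ := by
  obtain ⟨V, rfl⟩ := hUu
  set c : ℝ := (‖(↑V⁻¹ : H →L[ℂ] H)‖ + 1)⁻¹ with hc
  have hc0 : 0 < c := by positivity
  have hlow (z : H) : c * ‖z‖ ≤ ‖(V : H →L[ℂ] H) z‖ := by
    have hz : (↑V⁻¹ : H →L[ℂ] H) ((V : H →L[ℂ] H) z) = z := by
      rw [← mul_apply_eq_comp, V.inv_mul, one_apply_eq_self]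
    rw [hc, inv_mul_le_iff₀ (by positivity)]
    calc ‖z‖ ≤ ‖(↑V⁻¹ : H →L[ℂ] H)‖ * ‖(V : H →L[ℂ] H) z‖ := by
          conv_lhs => rw [← hz]
          exact ContinuousLinearMap.le_opNorm _ _
      _ ≤ _ := by gcongr; simp
  refine ⟨c ^ 2, max (c ^ 2) (‖(V : H →L[ℂ] H)‖ ^ 2), by positivity, le_max_left .., fun x _ => ?_⟩
  have hsum := hasSum_analysisOp (hπ.isBesselVector_bicommutant hξ hU) x
  refine ⟨hsum.summable, ?_, ?_⟩
  · rw [hsum.tsum_eq, ← mul_pow]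
    gcongr
    exact hπ.le_norm_analysisOp hξ hU hc0.le hlow x
  · rw [hsum.tsum_eq]
    calc _ ≤ (‖(V : H →L[ℂ] H)‖ * ‖x‖) ^ 2 := by
          gcongr
          exact hπ.norm_analysisOp_le hξ hU (norm_nonneg _) (ContinuousLinearMap.le_opNorm _) x
      _ ≤ _ := by rw [mul_pow]; gcongr; exact le_max_right ..

/-- Finiteness of the bicommutant: isometric images `a n ξ` with pairwise orthogonal ranges
must vanish. -/
lemma eq_zero_of_star_mul_eq_zero (hπ : IsProjUnitaryRep mu π) {ξ : H}
    (hξ : IsParsevalFrameOn π ξ Set.univ) {a : ℕ → H →L[ℂ] H}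
    (ha : ∀ n, a n ∈ commutant (commutant (Set.range π))) (hle : ∀ n z, ‖a n z‖ ≤ ‖z‖)
    (horth : ∀ i j, i ≠ j → star (a i) * a j = 0) {r : ℝ} (hr : ∀ n, ‖a n ξ‖ = r) : r = 0 := by
  have hB (n : ℕ) := hπ.isBesselVector_bicommutant hξ (ha n)
  let f : ℕ → lp (fun _ : G => ℂ) 2 := fun n => analysisOp π (a n ξ) (hB n) (a n ξ)
  have hf (n : ℕ) : ‖f n‖ ≤ r := by
    simpa [hr] using hπ.norm_analysisOp_le hξ (ha n) zero_le_one (by simpa using hle n) (a n ξ)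
  have hf0 (i j : ℕ) (hij : i ≠ j) : ⟪f i, f j⟫_ℂ = 0 := by
    have hmem := hπ.adjoint_analysisOp_comp_mem (hB i) (hB j)
    have hz := congrArg (fun T : H →L[ℂ] H => T
      (((analysisOp π (a j ξ) (hB j)).adjoint ∘L analysisOp π (a i ξ) (hB i)) ξ))
      (horth j i hij.symm)
    simp only [mul_apply_eq_comp, commute_of_mem_bicommutant (ha i) hmem] at hz
    rw [ContinuousLinearMap.star_eq_adjoint] at hz
    have h := ContinuousLinearMap.adjoint_inner_left (a j) ξ
      (((analysisOp π (a j ξ) (hB j)).adjoint ∘L analysisOp π (a i ξ) (hB i)) (a i ξ))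
    rw [hz] at h
    simpa [ContinuousLinearMap.adjoint_inner_left] using h.symm
  have hnorm (N : ℕ) : ‖∑ n ∈ Finset.range N, f n‖ ^ 2 ≤ N * r ^ 2 := by
    induction N with
    | zero => simp
    | succ N ih =>
      have h0 : ⟪∑ n ∈ Finset.range N, f n, f N⟫_ℂ = 0 := by
        rw [sum_inner]
        exact Finset.sum_eq_zero fun n hn => hf0 n N (Finset.mem_range.mp hn).ne
      have h := norm_add_sq_eq_norm_sq_add_norm_sq_of_inner_eq_zero _ _ h0
      rw [Finset.sum_range_succ, sq, h, ← sq, ← sq]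
      push_cast
      have := pow_le_pow_left₀ (norm_nonneg _) (hf N) 2
      linarith
  have heval (N : ℕ) : (N : ℝ) * r ^ 2 ≤ ‖∑ n ∈ Finset.range N, f n‖ := by
    refine le_trans (le_of_eq ?_) (lp.norm_apply_le_norm two_ne_zero _ (1 : G))
    have h1 (n : ℕ) : f n 1 = star (mu 1 1) * (r : ℂ) ^ 2 := by
      simp only [f, analysisOp_apply, hπ.map_one_apply, inner_smul_left, inner_self_eq_norm_sq_to_K,
        hr]
      rfl
    rw [lp.coeFn_sum, Finset.sum_apply]
    simp [h1, hπ.1]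
  have hr0 : 0 ≤ r := hr 0 ▸ norm_nonneg _
  by_contra hne
  have hpos : 0 < r ^ 2 := by positivity
  obtain ⟨N, hN⟩ := exists_nat_gt (1 / r ^ 2)
  rw [div_lt_iff₀ hpos] at hN
  have h1 := (pow_le_pow_left₀ (by positivity) (heval N) 2).trans (hnorm N)
  nlinarith

/-- A projection `e` of the bicommutant is zero if there is an operator `u` of the bicommutant
acting isometrically on the ranges of all `u ^ k * e` and whose range is orthogonal to that
of `e`. -/
lemma eq_zero_of_isometric_powers (hπ : IsProjUnitaryRep mu π) {ξ : H}
    (hξ : IsParsevalFrameOn π ξ Set.univ) {u e : H →L[ℂ] H}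
    (hu : u ∈ commutant (commutant (Set.range π)))
    (he : e ∈ commutant (commutant (Set.range π))) (hsa : IsSelfAdjoint e) (hee : e * e = e)
    (heu : e * u = 0) (hiso : ∀ k : ℕ, star u * (u * (u ^ k * e)) = u ^ k * e) : e = 0 := by
  have hcancel (i m : ℕ) : star u ^ i * (u ^ (i + m) * e) = u ^ m * e := by
    induction i with
    | zero => simp
    | succ i ih =>
      rw [← ih, pow_succ, mul_assoc, add_right_comm, pow_succ', mul_assoc u, hiso]
  have hlt (i j : ℕ) (hij : i < j) : e * (star u ^ i * (u ^ j * e)) = 0 := by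
    obtain ⟨m, rfl⟩ := Nat.exists_eq_add_of_lt hij
    rw [add_assoc, hcancel, pow_succ', ← mul_assoc, ← mul_assoc, heu, zero_mul, zero_mul]
  have hne (i j : ℕ) (hij : i ≠ j) : e * (star u ^ i * (u ^ j * e)) = 0 := by
    rcases hij.lt_or_gt with h | h
    · exact hlt i j h
    · simpa [hsa.star_eq, mul_assoc] using congrArg star (hlt j i h)
  have hupow (n : ℕ) : u ^ n ∈ commutant (commutant (Set.range π)) :=
    pow_mem (S := Submonoid.centralizer (commutant (Set.range π))) hu n
  have hπmem (h : G) : π h ∈ commutant (commutant (Set.range π)) :=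
    Set.subset_centralizer_centralizer ⟨h, rfl⟩
  have henorm (z : H) : ‖e z‖ ≤ ‖z‖ := by
    have h : ⟪e z, e z⟫_ℂ = ⟪z, e z⟫_ℂ := by
      conv_lhs => rw [← ContinuousLinearMap.adjoint_inner_right,
        ← ContinuousLinearMap.star_eq_adjoint, hsa.star_eq, ← mul_apply_eq_comp, hee]
    have h2 := norm_inner_le_norm (𝕜 := ℂ) z (e z)
    rw [← h, inner_self_eq_norm_sq_to_K] at h2
    norm_cast at h2
    rw [abs_of_nonneg (by positivity)] at h2
    nlinarith [norm_nonneg (e z), norm_nonneg z]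
  have hunorm (n : ℕ) (z : H) : ‖(u ^ n * e) z‖ = ‖e z‖ := by
    have h : ⟪(u ^ n * e) z, (u ^ n * e) z⟫_ℂ = ⟪e z, e z⟫_ℂ := by
      conv_lhs => rw [mul_apply_eq_comp, ← ContinuousLinearMap.adjoint_inner_left,
        ← ContinuousLinearMap.star_eq_adjoint, star_pow, ← mul_apply_eq_comp, ← mul_apply_eq_comp]
      rw [mul_assoc, show star u ^ n * (u ^ n * e) = e by simpa using hcancel n 0]
    rw [inner_self_eq_norm_sq_to_K, inner_self_eq_norm_sq_to_K] at h
    exact (pow_left_inj₀ (norm_nonneg _) (norm_nonneg _) two_ne_zero).mp (by exact_mod_cast h)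
  have hzero (h : G) : e (π h ξ) = 0 := by
    rw [← norm_eq_zero]
    refine hπ.eq_zero_of_star_mul_eq_zero hξ (a := fun n => u ^ n * e * π h)
      (fun n => Set.mul_mem_centralizer (Set.mul_mem_centralizer (hupow n) he) (hπmem h))
      (fun n z => ?_) (fun i j hij => ?_) (fun n => ?_)
    · rw [mul_apply_eq_comp, hunorm, ← (hπ.2.1 h).1 z]
      exact henorm _
    · have := congrArg (fun T => star (π h) * (T * π h)) (hne i j hij)
      simpa [hsa.star_eq, mul_assoc] using this
    · rw [mul_apply_eq_comp, hunorm]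
  ext x
  have h (g : G) : ⟪e x, π g ξ⟫_ℂ = 0 := by
    rw [← ContinuousLinearMap.adjoint_inner_right, ← ContinuousLinearMap.star_eq_adjoint,
      hsa.star_eq, hzero, inner_zero_right]
  have hx0 := hξ (e x) trivial
  simp only [h, norm_zero, ne_eq, OfNat.ofNat_ne_zero, not_false_eq_true, zero_pow] at hx0
  simpa using hx0.unique hasSum_zero


lemma norm_star_apply_eq (hπ : IsProjUnitaryRep mu π) {ξ η : H}
    (hξ : IsParsevalFrameOn π ξ Set.univ) (hη : IsParsevalFrameOn π η Set.univ) {S : H →L[ℂ] H}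
    (hS : S ∈ commutant (Set.range π)) : ‖star S ξ‖ = ‖S η‖ := by
  refine (pow_left_inj₀ (norm_nonneg _) (norm_nonneg _) two_ne_zero).mp ?_
  refine (hη _ trivial).unique ?_
  convert hπ.hasSum_norm_inner_swap (hξ (S η) trivial) using 4 with g
  rw [inner_star_apply_left, ← mul_apply_eq_comp, ← hS _ ⟨g, rfl⟩, mul_apply_eq_comp]

/-- All Parseval frame vectors induce the same vector state on the commutant. -/
lemma inner_apply_self_eq (hπ : IsProjUnitaryRep mu π) {ξ η : H}
    (hξ : IsParsevalFrameOn π ξ Set.univ) (hη : IsParsevalFrameOn π η Set.univ) {S : H →L[ℂ] H}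
    (hS : S ∈ commutant (Set.range π)) : ⟪S ξ, ξ⟫_ℂ = ⟪S η, η⟫_ℂ := by
  have hnorm {T : H →L[ℂ] H} (hT : T ∈ commutant (Set.range π)) : ‖T ξ‖ = ‖T η‖ :=
    (hπ.norm_star_apply_eq hξ hξ hT).symm.trans (hπ.norm_star_apply_eq hξ hη hT)
  have hmem (c : ℂ) : S + c • 1 ∈ commutant (Set.range π) :=
    Set.add_mem_centralizer hS fun T _ => by simp
  have h (c : ℂ) : ‖S ξ + c • ξ‖ = ‖S η + c • η‖ := by simpa using hnorm (hmem c)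
  have h0 := h 1
  have h1 := h (-1)
  have h2 := h Complex.I
  have h3 := h (-Complex.I)
  simp only [one_smul, neg_smul, ← sub_eq_add_neg] at h0 h1 h2 h3
  rw [inner_eq_sum_norm_sq_div_four, inner_eq_sum_norm_sq_div_four]
  simp only [RCLike.I_to_complex]
  rw [h0, h1, h2, h3]

/-- Any two Parseval frame vectors are related by a unitary of the bicommutant. -/
lemma exists_unitary (hπ : IsProjUnitaryRep mu π) {ξ η : H}
    (hξ : IsParsevalFrameOn π ξ Set.univ) (hη : IsParsevalFrameOn π η Set.univ) :
    ∃ U ∈ commutant (commutant (Set.range π)), U ∈ unitary (H →L[ℂ] H) ∧ U ξ = η := by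
  obtain ⟨w, hw, hwξ, hwww, hmax⟩ := exists_maximal_partialIsometry
    (M := commutant (Set.range π)) Set.one_mem_centralizer
    (fun _ hS _ hT => Set.mul_mem_centralizer hS hT) (fun _ hS => hπ.star_mem_commutant hS)
    fun _ hS => hπ.inner_apply_self_eq hξ hη hS
  let N : Subalgebra ℂ (H →L[ℂ] H) := Subalgebra.centralizer ℂ (commutant (Set.range π))
  have hwN : w ∈ N := hw
  have hwN' : star w ∈ N := hπ.star_mem_bicommutant hw
  have hwww' : star w * (w * star w) = star w := by
    simpa [mul_assoc] using congrArg star hwww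
  have h1 : star w * w = 1 := by
    have heN : 1 - star w * w ∈ N := sub_mem (one_mem N) (mul_mem hwN' hwN)
    have heu : (1 - star w * w) * star w = 0 := by
      rw [sub_mul, one_mul, mul_assoc, hwww', sub_self]
    refine (sub_eq_zero.mp (hπ.eq_zero_of_isometric_powers hξ hwN' heN (by simp [IsSelfAdjoint])
      ?_ heu fun k => ?_)).symm
    · rw [mul_sub, mul_one, ← mul_assoc, heu, zero_mul, sub_zero]
    · rw [star_star]
      have hxN : star w ^ k * (1 - star w * w) ∈ N := mul_mem (pow_mem hwN' k) heN
      have hxw : star w ^ k * (1 - star w * w) * star w = 0 := by rw [mul_assoc, heu, mul_zero]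
      generalize star w ^ k * (1 - star w * w) = x at hxN hxw ⊢
      refine (sub_eq_zero.mp (hmax (x - w * (star w * x)) ?_ ?_ ?_)).symm
      · exact sub_mem hxN (mul_mem hwN (mul_mem hwN' hxN))
      · rw [sub_mul, mul_assoc, mul_assoc, hxw, mul_zero, mul_zero, sub_zero]
      · rw [mul_sub, ← mul_assoc w, ← mul_assoc (star w), hwww', sub_self]
  have h2 : w * star w = 1 := by
    have heN : 1 - w * star w ∈ N := sub_mem (one_mem N) (mul_mem hwN hwN')
    have heu : (1 - w * star w) * w = 0 := by
      rw [sub_mul, one_mul, mul_assoc, hwww, sub_self]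
    refine (sub_eq_zero.mp (hπ.eq_zero_of_isometric_powers hξ hwN heN (by simp [IsSelfAdjoint])
      ?_ heu fun k => ?_)).symm
    · rw [mul_sub, mul_one, ← mul_assoc, heu, zero_mul, sub_zero]
    · rw [← mul_assoc, h1, one_mul]
  exact ⟨w, hw, Unitary.mem_iff.mpr ⟨h1, h2⟩, hwξ⟩

/-- Any frame vector is the image of a Parseval frame vector under an invertible operator of the
bicommutant. -/
lemma exists_isUnit (hπ : IsProjUnitaryRep mu π) {ξ η : H}
    (hξ : IsParsevalFrameOn π ξ Set.univ) (hη : IsFrameOn π η Set.univ) :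
    ∃ U ∈ commutant (commutant (Set.range π)), IsUnit U ∧ U ξ = η := by
  have hb := hη.isBesselVector
  obtain ⟨S, hS0, hSS, hSn, hcomm⟩ := exists_nonneg_mul_self (analysisOp π η hb)
  have hsa : IsSelfAdjoint S := hS0.isSelfAdjoint
  have hSu : IsUnit S := by
    obtain ⟨A, B, hA, -, h⟩ := hη
    have hD : IsUnit (S * S) := by
      refine ContinuousLinearMap.isUnit_of_forall_le_norm_inner_map _ (c := ⟨A, hA.le⟩) hA
        fun x => ?_
      rw [mul_apply_eq_comp, inner_apply_left_eq_star, hsa.star_eq, inner_self_eq_norm_sq_to_K,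
        norm_pow, RCLike.norm_ofReal, abs_norm, hSn, ← (hasSum_analysisOp hb x).tsum_eq, mul_comm]
      exact (h x trivial).2.1
    exact ((Commute.refl S).isUnit_mul_iff.mp hD).1
  obtain ⟨a, b, hb0, hba, u, hu, hSu', hcommu⟩ := exists_unitary_of_isUnit_nonneg hS0 hSu
  have hSmem : S ∈ commutant (Set.range π) := fun T hT =>
    (hcomm T (hπ.adjoint_analysisOp_comp_mem hb hb T hT).symm).symm
  have humem : u ∈ commutant (Set.range π) := fun T hT => (hcommu T (hSmem T hT).symm).symm
  have huξ : IsParsevalFrameOn π (u ξ) Set.univ := by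
    intro x _
    have hnorm : ‖star u x‖ = ‖x‖ :=
      ContinuousLinearMap.norm_map_of_mem_unitary (Unitary.star_mem hu) x
    rw [← hnorm]
    convert hξ (star u x) trivial using 4 with g
    rw [inner_star_apply_left, ← mul_apply_eq_comp, ← mul_apply_eq_comp, humem _ ⟨g, rfl⟩]
  obtain ⟨V, hV, hVu, hVξ⟩ := hπ.exists_unitary hξ huξ
  obtain ⟨S, rfl⟩ := hSu
  have hSη : IsParsevalFrameOn π ((↑S⁻¹ : H →L[ℂ] H) η) Set.univ := by
    intro x _
    have hSx : (S : H →L[ℂ] H) ((↑S⁻¹ : H →L[ℂ] H) x) = x := by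
      rw [← mul_apply_eq_comp, Units.mul_inv, one_apply_eq_self]
    have hinv : IsSelfAdjoint (↑S⁻¹ : H →L[ℂ] H) := by
      refine left_inv_eq_right_inv (a := (S : H →L[ℂ] H)) ?_ S.mul_inv
      conv_lhs => rw [← hsa.star_eq]
      rw [← star_mul, S.mul_inv, star_one]
    have hinvmem : (↑S⁻¹ : H →L[ℂ] H) ∈ commutant (Set.range π) := fun T hT =>
      Commute.units_inv_right (hSmem T hT)
    have := hasSum_analysisOp hb ((↑S⁻¹ : H →L[ℂ] H) x)
    rw [← hSn, hSx] at this
    convert this using 4 with g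
    rw [inner_apply_left_eq_star, hinv.star_eq, ← mul_apply_eq_comp, ← mul_apply_eq_comp,
      hinvmem _ ⟨g, rfl⟩]
  obtain ⟨U, hU, hUu, hUξ⟩ := hπ.exists_unitary hξ hSη
  have hVξ' : star V ξ = star u ξ := by
    have h1 : star V (u ξ) = ξ := by
      rw [← hVξ, ← mul_apply_eq_comp, (Unitary.mem_iff.mp hVu).1, one_apply_eq_self]
    rw [commute_of_mem_bicommutant (hπ.star_mem_bicommutant hV) humem] at h1
    rw [← congrArg (star u : H →L[ℂ] H) h1, ← mul_apply_eq_comp, (Unitary.mem_iff.mp hu).1,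
      one_apply_eq_self]
  let A : H →L[ℂ] H := (a : ℂ) • 1 + ((b / 2 : ℝ) : ℂ) • (V + star V)
  have hAmem : A ∈ Subalgebra.centralizer ℂ (commutant (Set.range π)) :=
    add_mem (Subalgebra.smul_mem _ (one_mem _) _)
      (Subalgebra.smul_mem _ (add_mem hV (hπ.star_mem_bicommutant hV)) _)
  have hAξ : A ξ = (S : H →L[ℂ] H) ξ := by
    rw [hSu']
    simp [A, hVξ, hVξ']
  have hAu : IsUnit A := by
    have hnorm {T : H →L[ℂ] H} (hT : T ∈ unitary (H →L[ℂ] H)) : ‖T‖ ≤ 1 :=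
      T.opNorm_le_bound zero_le_one fun x => by
        rw [ContinuousLinearMap.norm_map_of_mem_unitary hT, one_mul]
    have ha : 0 < a := hb0.trans hba
    have ha' : (a : ℂ) ≠ 0 := by exact_mod_cast ha.ne'
    have hA : A = (a : ℂ) • (1 - (((-(b / (2 * a))) : ℝ) : ℂ) • (V + star V)) := by
      rw [smul_sub, smul_smul, sub_eq_add_neg, ← neg_smul]
      push_cast
      field_simp
      simp [A]
    rw [hA]
    refine IsUnit.smul (Units.mk0 (a : ℂ) ha') (isUnit_one_sub_of_norm_lt_one ?_)
    rw [norm_smul, Complex.norm_real, norm_neg, Real.norm_of_nonneg (by positivity)]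
    calc _ ≤ b / (2 * a) * (1 + 1) := by
          gcongr
          exact (norm_add_le _ _).trans (add_le_add (hnorm hVu) (hnorm (Unitary.star_mem hVu)))
      _ = b / a := by field_simp; norm_num
      _ < 1 := (div_lt_one ha).mpr hba
  refine ⟨U * A, Set.mul_mem_centralizer hU hAmem,
    (Unitary.toUnits ⟨U, hUu⟩).isUnit.mul hAu, ?_⟩
  rw [mul_apply_eq_comp, hAξ, commute_of_mem_bicommutant hU hSmem, hUξ, ← mul_apply_eq_comp]
  simp
end IsProjUnitaryRep

end FrameVectors

/-- **Parameterization of Parseval frame vectors and frame vectors.** If `{π g ξ}` is a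
Parseval frame for `H`, then (i) `{π g η}` is a Parseval frame for `H` iff `η = U ξ` for
some unitary `U ∈ π(G)''`, and (ii) `{π g η}` is a frame for `H` iff `η = U ξ` for some
invertible `U ∈ π(G)''`. -/
theorem parameterization_frame_vectors
    {G : Type*} [Group G] [Countable G]
    {H : Type*} [NormedAddCommGroup H] [InnerProductSpace ℂ H] [CompleteSpace H]
    [TopologicalSpace.SeparableSpace H]
    (mu : G → G → ℂ) (π : G → H →L[ℂ] H) (hπ : IsProjUnitaryRep mu π)
    (ξ : H) (hξ : IsParsevalFrameOn π ξ Set.univ) (η : H) :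
    (IsParsevalFrameOn π η Set.univ ↔
      ∃ U ∈ commutant (commutant (Set.range π)), U ∈ unitary (H →L[ℂ] H) ∧ η = U ξ) ∧
    (IsFrameOn π η Set.univ ↔
      ∃ U ∈ commutant (commutant (Set.range π)), IsUnit U ∧ η = U ξ) :=
  ⟨⟨fun hη => (hπ.exists_unitary hξ hη).imp fun _ ⟨hU, hUu, h⟩ => ⟨hU, hUu, h.symm⟩,
      fun ⟨_, hU, hUu, h⟩ => h ▸ hπ.isParsevalFrameOn_unitary hξ hU hUu⟩,
    ⟨fun hη => (hπ.exists_isUnit hξ hη).imp fun _ ⟨hU, hUu, h⟩ => ⟨hU, hUu, h.symm⟩,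
      fun ⟨_, hU, hUu, h⟩ => h ▸ hπ.isFrameOn_isUnit hξ hU hUu⟩⟩
end

section
/- Let π be a μ-projective unitary representation of a countable discrete group G on a complex separable Hilbert space H that admits a complete frame vector. Then the set B_π of Bessel vectors of π is dense in H. -/
open scoped InnerProductSpace

/-- The Bessel vectors of `π` form a linear subspace. -/
def besselSubmodule {G H : Type*} [NormedAddCommGroup H] [InnerProductSpace ℂ H]
    (π : G → H →L[ℂ] H) : Submodule ℂ H where
  carrier := {η | IsBesselVector π η}
  zero_mem' := ⟨1, one_pos, fun x s => by simp⟩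
  add_mem' := by
    rintro a b ⟨B, hB, ha⟩ ⟨C, hC, hb⟩
    refine ⟨2 * B + 2 * C, by positivity, fun x s => ?_⟩
    calc ∑ g ∈ s, ‖⟪x, π g (a + b)⟫_ℂ‖ ^ 2
        ≤ ∑ g ∈ s, (2 * ‖⟪x, π g a⟫_ℂ‖ ^ 2 + 2 * ‖⟪x, π g b⟫_ℂ‖ ^ 2) := by
          refine Finset.sum_le_sum fun g _ => ?_
          rw [map_add, inner_add_right]
          calc ‖⟪x, π g a⟫_ℂ + ⟪x, π g b⟫_ℂ‖ ^ 2
              ≤ (‖⟪x, π g a⟫_ℂ‖ + ‖⟪x, π g b⟫_ℂ‖) ^ 2 := by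
                gcongr
                exact norm_add_le _ _
            _ ≤ _ := by nlinarith [sq_nonneg (‖⟪x, π g a⟫_ℂ‖ - ‖⟪x, π g b⟫_ℂ‖)]
      _ ≤ (2 * B + 2 * C) * ‖x‖ ^ 2 := by
          rw [Finset.sum_add_distrib, ← Finset.mul_sum, ← Finset.mul_sum]
          linarith [ha x s, hb x s]
  smul_mem' := by
    rintro c a ⟨B, hB, ha⟩
    refine ⟨(‖c‖ ^ 2 + 1) * B, by positivity, fun x s => ?_⟩
    simp only [map_smul, inner_smul_right, norm_mul, mul_pow, ← Finset.mul_sum]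
    rw [mul_assoc]
    exact mul_le_mul (by linarith) (ha x s) (by positivity) (by positivity)

/-- The Bessel vectors of a projective unitary representation are invariant under it. -/
lemma IsBesselVector.apply {G H : Type*} [Group G] [NormedAddCommGroup H]
    [InnerProductSpace ℂ H] {mu : G → G → ℂ} {π : G → H →L[ℂ] H}
    (hπ : IsProjUnitaryRep mu π) {ξ : H} (hξ : IsBesselVector π ξ) (h : G) :
    IsBesselVector π (π h ξ) := by
  obtain ⟨B, hB, hb⟩ := hξ
  refine ⟨B, hB, fun x s => ?_⟩
  have key (g : G) : ‖⟪x, π g (π h ξ)⟫_ℂ‖ = ‖⟪x, π (g * h) ξ⟫_ℂ‖ := by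
    have hg : π g (π h ξ) = mu g h • π (g * h) ξ := DFunLike.congr_fun (hπ.2.2 g h) ξ
    rw [hg, inner_smul_right, norm_mul, hπ.1, one_mul]
  simpa [key] using hb x (s.map (mulRightEmbedding h))

/-- A complete frame vector is a Bessel vector. -/
lemma IsCompleteFrameVector.isBesselVector {G H : Type*} [NormedAddCommGroup H]
    [InnerProductSpace ℂ H] {π : G → H →L[ℂ] H} {ξ : H} (hξ : IsCompleteFrameVector π ξ) :
    IsBesselVector π ξ := by
  obtain ⟨A, B, hA, hAB, hf⟩ := hξ
  refine ⟨B, hA.trans_le hAB, fun x s => ?_⟩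
  obtain ⟨hs, -, hu⟩ := hf x (Set.mem_univ x)
  exact (hs.sum_le_tsum s fun _ _ => by positivity).trans hu

/-- A vector orthogonal to the orbit of a complete frame vector vanishes. -/
lemma IsCompleteFrameVector.eq_zero_of_inner_eq_zero {G H : Type*} [NormedAddCommGroup H]
    [InnerProductSpace ℂ H] {π : G → H →L[ℂ] H} {ξ : H} (hξ : IsCompleteFrameVector π ξ)
    {x : H} (hx : ∀ g, ⟪x, π g ξ⟫_ℂ = 0) : x = 0 := by
  obtain ⟨A, B, hA, -, hf⟩ := hξ
  have hl := (hf x (Set.mem_univ x)).2.1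
  simp only [hx, norm_zero, ne_eq, OfNat.ofNat_ne_zero, not_false_eq_true, zero_pow,
    tsum_zero] at hl
  have hsq : ‖x‖ ^ 2 = 0 := le_antisymm (nonpos_of_mul_nonpos_right hl hA) (sq_nonneg _)
  simpa using hsq

/-- **Density of Bessel vectors for frame representations.** If a projective unitary
representation `π` of a countable group `G` on a complex separable Hilbert space `H`
admits a complete frame vector, then the Bessel vectors of `π` are dense in `H`. -/
theorem bessel_vectors_dense
    {G : Type*} [Group G] [Countable G]
    {H : Type*} [NormedAddCommGroup H] [InnerProductSpace ℂ H] [CompleteSpace H]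
    [TopologicalSpace.SeparableSpace H]
    (mu : G → G → ℂ) (π : G → H →L[ℂ] H) (hπ : IsProjUnitaryRep mu π)
    (hcfv : ∃ ξ : H, IsCompleteFrameVector π ξ) :
    Dense {η : H | IsBesselVector π η} := by
  obtain ⟨ξ, hξ⟩ := hcfv
  change Dense (besselSubmodule π : Set H)
  rw [Submodule.dense_iff_topologicalClosure_eq_top, Submodule.topologicalClosure_eq_top_iff,
    Submodule.eq_bot_iff]
  exact fun x hx => hξ.eq_zero_of_inner_eq_zero fun g =>
    Submodule.inner_left_of_mem_orthogonal (hξ.isBesselVector.apply hπ g :) hx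
end

section
/- Let G be a countable discrete group, μ a multiplier for G, and let λ and ρ be the left and right regular μ-projective representations of G on ℓ²(G), given by λ_g χ_h = μ(g,h)χ_{gh} and ρ_g χ_h = μ(h, g⁻¹)χ_{hg⁻¹}. Then the commutant of {λ_g : g ∈ G} equals the double commutant of {ρ_g : g ∈ G}: λ(G)' = ρ(G)''. -/
open scoped InnerProductSpace

/-- `mu` is a multiplier for `G`: unimodular, cocycle identity, normalized at the unit. -/
def IsMultiplier {G : Type*} [Group G] (mu : G → G → ℂ) : Prop :=
  (∀ g h, ‖mu g h‖ = 1) ∧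
  (∀ g₁ g₂ g₃ : G, mu g₁ (g₂ * g₃) * mu g₂ g₃ = mu (g₁ * g₂) g₃ * mu g₁ g₂) ∧
  (∀ g : G, mu g 1 = 1 ∧ mu 1 g = 1)

namespace RegularProjRep

variable {G : Type*}

open Classical in
/-- The standard basis vector `χ_h` of `ℓ²(G)`. -/
noncomputable def delta (h : G) : lp (fun _ : G => ℂ) 2 := lp.single 2 h (1 : ℂ)

open Classical in
lemma delta_apply (h k : G) : (delta h : lp (fun _ : G => ℂ) 2) k = if k = h then 1 else 0 := by
  simp [delta, lp.single_apply, Pi.single_apply]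

open Classical in
/-- The matrix expansion of a bounded operator on `ℓ²(G)`. -/
lemma hasSum_apply (T : lp (fun _ : G => ℂ) 2 →L[ℂ] lp (fun _ : G => ℂ) 2)
    (F : lp (fun _ : G => ℂ) 2) (k : G) :
    HasSum (fun m => F m * T (delta m) k) (T F k) := by
  have hF := lp.hasSum_single (E := fun _ : G => ℂ) (p := 2) (by simp) F
  have h := hF.mapL ((lp.evalCLM ℂ (fun _ : G => ℂ) 2 k).comp T)
  have hsingle (m : G) :
      lp.single (E := fun _ : G => ℂ) 2 m (F m) = F m • (delta m : lp (fun _ : G => ℂ) 2) := by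
    simp [delta, ← lp.single_smul]
  simp only [hsingle, map_smul] at h
  exact h

/-- Bounded operators on `ℓ²(G)` with the same matrix are equal. -/
lemma ext_delta {T S : lp (fun _ : G => ℂ) 2 →L[ℂ] lp (fun _ : G => ℂ) 2}
    (h : ∀ m k, T (delta m) k = S (delta m) k) : T = S := by
  ext F k
  refine (hasSum_apply T F k).unique ?_
  simpa only [h] using hasSum_apply S F k

variable [Group G] {mu : G → G → ℂ}
  {lam rho : G → (lp (fun _ : G => ℂ) 2 →L[ℂ] lp (fun _ : G => ℂ) 2)}

lemma commute_left_right (hmu : IsMultiplier mu)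
    (hlam : ∀ (g : G) (F : lp (fun _ : G => ℂ) 2) (k : G), lam g F k = mu g (g⁻¹ * k) * F (g⁻¹ * k))
    (hrho : ∀ (g : G) (F : lp (fun _ : G => ℂ) 2) (k : G), rho g F k = mu (k * g) g⁻¹ * F (k * g))
    (g h : G) :
    lam g * rho h = rho h * lam g := by
  ext F k
  simp only [mul_apply_eq_comp, hlam, hrho]
  have hc := hmu.2.1 g (g⁻¹ * k * h) h⁻¹
  simp only [mul_inv_cancel_right, ← mul_assoc, mul_inv_cancel, one_mul] at hc
  rw [← mul_assoc, hc, ← mul_assoc g⁻¹ k h, mul_assoc]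

lemma apply_delta_of_mem_commutant_left (hmu : IsMultiplier mu)
    (hlam : ∀ (g : G) (F : lp (fun _ : G => ℂ) 2) (k : G), lam g F k = mu g (g⁻¹ * k) * F (g⁻¹ * k))
    {T : lp (fun _ : G => ℂ) 2 →L[ℂ] lp (fun _ : G => ℂ) 2} (hT : T ∈ commutant (Set.range lam))
    (h k : G) :
    T (delta h) k = mu h (h⁻¹ * k) * T (delta 1) (h⁻¹ * k) := by
  have hd : lam h (delta 1) = delta h := by
    ext k
    by_cases hk : k = h
    · simp [hlam, delta_apply, hk, (hmu.2.2 h).1]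
    · simp [hlam, delta_apply, hk, inv_mul_eq_one, Ne.symm hk]
  rw [← hlam, ← hd]
  exact congrArg (· k) (congrArg Subtype.val (DFunLike.congr_fun (hT _ ⟨h, rfl⟩) (delta 1))).symm

lemma apply_delta_of_mem_commutant_right (hmu : IsMultiplier mu)
    (hrho : ∀ (g : G) (F : lp (fun _ : G => ℂ) 2) (k : G), rho g F k = mu (k * g) g⁻¹ * F (k * g))
    {S : lp (fun _ : G => ℂ) 2 →L[ℂ] lp (fun _ : G => ℂ) 2} (hS : S ∈ commutant (Set.range rho))
    (h k : G) :
    S (delta h) k = mu (k * h⁻¹) h * S (delta 1) (k * h⁻¹) := by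
  have hd : rho h⁻¹ (delta 1) = delta h := by
    ext k
    by_cases hk : k = h
    · simp [hrho, delta_apply, hk, (hmu.2.2 h).2]
    · simp [hrho, delta_apply, hk, mul_inv_eq_one]
  have hk := hrho h⁻¹ (S (delta 1)) k
  rw [inv_inv] at hk
  rw [← hk, ← hd]
  exact congrArg (· k) (congrArg Subtype.val (DFunLike.congr_fun (hS _ ⟨h⁻¹, rfl⟩) (delta 1))).symm

lemma commute_of_mem_commutants (hmu : IsMultiplier mu)
    (hlam : ∀ (g : G) (F : lp (fun _ : G => ℂ) 2) (k : G), lam g F k = mu g (g⁻¹ * k) * F (g⁻¹ * k))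
    (hrho : ∀ (g : G) (F : lp (fun _ : G => ℂ) 2) (k : G), rho g F k = mu (k * g) g⁻¹ * F (k * g))
    {T S : lp (fun _ : G => ℂ) 2 →L[ℂ] lp (fun _ : G => ℂ) 2} (hT : T ∈ commutant (Set.range lam))
    (hS : S ∈ commutant (Set.range rho)) : S * T = T * S := by
  refine ext_delta fun h k => ?_
  have hST := hasSum_apply S (T (delta h)) k
  have hTS := hasSum_apply T (S (delta h)) k
  let e : G ≃ G := (Equiv.inv G).trans ((Equiv.mulLeft h).trans (Equiv.mulRight k))
  rw [← e.hasSum_iff] at hST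
  refine hST.unique ?_
  rw [mul_apply_eq_comp]
  convert hTS using 1
  funext m
  have he : e m = h * m⁻¹ * k := rfl
  simp only [Function.comp_apply, he]
  rw [apply_delta_of_mem_commutant_left hmu hlam hT h,
    apply_delta_of_mem_commutant_left hmu hlam hT m,
    apply_delta_of_mem_commutant_right hmu hrho hS h,
    apply_delta_of_mem_commutant_right hmu hrho hS (h * m⁻¹ * k)]
  have hc := hmu.2.1 (m * h⁻¹) h (m⁻¹ * k)
  have h1 : h⁻¹ * (h * m⁻¹ * k) = m⁻¹ * k := by group
  have h2 : k * (h * m⁻¹ * k)⁻¹ = m * h⁻¹ := by group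
  rw [inv_mul_cancel_right, ← mul_assoc h] at hc
  rw [h1, h2]
  linear_combination T (delta 1) (m⁻¹ * k) * S (delta 1) (m * h⁻¹) * hc

end RegularProjRep

/-- **Commutation theorem for regular projective representations.** Let `mu` be a
multiplier for a countable group `G` and let `lam`, `rho` be the left and right regular
`mu`-projective representations on `ℓ²(G)`, determined by `lam g χ_h = mu g h • χ_{g h}`
and `rho g χ_h = mu h g⁻¹ • χ_{h g⁻¹}`, i.e. in coordinates `(lam g F) k = mu g (g⁻¹ k) *
F (g⁻¹ k)` and `(rho g F) k = mu (k g) g⁻¹ * F (k g)`. Then `λ(G)' = ρ(G)''`. -/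
theorem left_regular_commutant_eq_right_regular_double_commutant
    {G : Type*} [Group G] [Countable G]
    (mu : G → G → ℂ) (hmu : IsMultiplier mu)
    (lam rho : G → (lp (fun _ : G => ℂ) 2 →L[ℂ] lp (fun _ : G => ℂ) 2))
    (hlam : ∀ (g : G) (F : lp (fun _ : G => ℂ) 2) (k : G),
      lam g F k = mu g (g⁻¹ * k) * F (g⁻¹ * k))
    (hrho : ∀ (g : G) (F : lp (fun _ : G => ℂ) 2) (k : G),
      rho g F k = mu (k * g) g⁻¹ * F (k * g)) :
    commutant (Set.range lam) = commutant (commutant (Set.range rho)) := by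
  apply Set.Subset.antisymm
  · intro T hT S hS
    exact RegularProjRep.commute_of_mem_commutants hmu hlam hrho hT hS
  · intro T hT
    rintro _ ⟨g, rfl⟩
    refine hT (lam g) ?_
    rintro _ ⟨h, rfl⟩
    exact (RegularProjRep.commute_left_right hmu hlam hrho g h).symm
end
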